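/- arXiv:1207.2369 — 3 statements merged into one kernel-verified Lean document; each statement's English description precedes it below -/
import Mathlib

section
/- Let f : I ⊆ [0,∞) → ℝ be differentiable on I° with f' integrable on [a,b], where a,b ∈ I° with a < b, and suppose |f'|^q is (α,m)-convex on [a,b] for (α,m) ∈ (0,1]² with mb > a, where q > 1 and 1/p + 1/q = 1. Define A₃ = |f'(a)|^q + m[2^α(α+1) − 1]|f'(b)|^q and B₃ = (2^{α+1} − 1)|f'(a)|^q + m[2^α(α+1) + 1 − 2^{α+1}]|f'(b)|^q. Then |(1/6)[f(a) + 4f((a+mb)/2) + f(mb)] − (1/(mb−a)) ∫ₐ^{mb} f(x) dx| ≤ ((mb−a)/12)((2^{p+1}+1)/(3(p+1)))^{1/p} (1/(2^α(α+1)))^{1/q} (A₃^{1/q} + B₃^{1/q}). -/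
open MeasureTheory Set Real

/-- A function `g` is `(α,m)`-convex on `s` if
`g (t*x + m*(1-t)*y) ≤ t^α * g x + m*(1-t^α) * g y` for all `x, y ∈ s` and `t ∈ [0,1]`. -/
def AlphaMConvexOn (s : Set ℝ) (α m : ℝ) (g : ℝ → ℝ) : Prop :=
  ∀ x ∈ s, ∀ y ∈ s, ∀ t ∈ Icc (0:ℝ) 1,
    g (t * x + m * (1 - t) * y) ≤ t ^ α * g x + m * (1 - t ^ α) * g y

/-- Hölder's inequality on a compact interval, for bounded measurable functions. -/
lemma abs_integral_mul_le_Lp_mul_Lq_of_bounded {u v p q M N : ℝ} (huv : u ≤ v)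
    (hpq : p.HolderConjugate q) {k g : ℝ → ℝ}
    (hk : IntervalIntegrable k volume u v) (hg : IntervalIntegrable g volume u v)
    (hkM : ∀ x ∈ Icc u v, |k x| ≤ M) (hgN : ∀ x ∈ Icc u v, |g x| ≤ N) :
    |∫ x in u..v, k x * g x|
      ≤ (∫ x in u..v, |k x| ^ p) ^ (1 / p) * (∫ x in u..v, |g x| ^ q) ^ (1 / q) := by
  refine (intervalIntegral.abs_integral_le_integral_abs huv).trans ?_
  simp only [intervalIntegral.integral_of_le huv, abs_mul]
  have hmem : ∀ {w : ℝ → ℝ} {L r : ℝ}, IntervalIntegrable w volume u v →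
      (∀ x ∈ Icc u v, |w x| ≤ L) →
      MemLp w (ENNReal.ofReal r) (volume.restrict (Ioc u v)) := fun hw hL =>
    MemLp.of_bound ((intervalIntegrable_iff_integrableOn_Ioc_of_le huv).1 hw).aestronglyMeasurable
      _ ((ae_restrict_iff' measurableSet_Ioc).2
        (Filter.Eventually.of_forall fun x hx => hL x (Ioc_subset_Icc_self hx)))
  exact integral_mul_norm_le_Lp_mul_Lq hpq (hmem hk hkM) (hmem hg hgN)

lemma integral_abs_sub_rpow {u k v p : ℝ} (huk : u ≤ k) (hkv : k ≤ v) (hp : 0 < p) :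
    ∫ x in u..v, |x - k| ^ p = ((k - u) ^ (p + 1) + (v - k) ^ (p + 1)) / (p + 1) := by
  have hc : Continuous fun x : ℝ => |x - k| ^ p :=
    (continuous_id.sub continuous_const).abs.rpow_const fun _ => Or.inr hp.le
  rw [← intervalIntegral.integral_add_adjacent_intervals (hc.intervalIntegrable u k)
    (hc.intervalIntegrable k v)]
  have hleft : ∫ x in u..k, |x - k| ^ p = ∫ x in u..k, (k - x) ^ p := by
    refine intervalIntegral.integral_congr fun x hx => ?_
    rw [uIcc_of_le huk] at hx
    rw [abs_sub_comm, abs_of_nonneg (by linarith [hx.2])]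
  have hright : ∫ x in k..v, |x - k| ^ p = ∫ x in k..v, (x - k) ^ p := by
    refine intervalIntegral.integral_congr fun x hx => ?_
    rw [uIcc_of_le hkv] at hx
    rw [abs_of_nonneg (by linarith [hx.1])]
  rw [hleft, hright, intervalIntegral.integral_comp_sub_left (fun x => x ^ p),
    intervalIntegral.integral_comp_sub_right (fun x => x ^ p),
    integral_rpow (Or.inl (by linarith)), integral_rpow (Or.inl (by linarith)), sub_self,
    zero_rpow (by linarith)]
  ring

lemma integral_sub_div_rpow {u v c h α : ℝ} (hh : 0 < h) (hα : 0 < α) :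
    ∫ x in u..v, ((c - x) / h) ^ α
      = h * ((((c - u) / h) ^ (α + 1) - ((c - v) / h) ^ (α + 1)) / (α + 1)) := by
  have := intervalIntegral.integral_comp_sub_div (a := u) (b := v) (fun x : ℝ => x ^ α) hh.ne'
    (c / h)
  simp only [← sub_div] at this
  rw [this, integral_rpow (Or.inl (by linarith)), smul_eq_mul]

/-- Integration by parts against the Peano kernel of Simpson's rule. -/
lemma simpson_sub_integral_eq {f f' : ℝ → ℝ} {a c : ℝ} (hac : a < c)
    (hderiv : ∀ x ∈ Icc a c, HasDerivAt f (f' x) x)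
    (hint : IntervalIntegrable f' volume a c) :
    (1 / 6) * (f a + 4 * f ((a + c) / 2) + f c) - (1 / (c - a)) * ∫ x in a..c, f x
      = (1 / (c - a)) * ((∫ x in a..(a + c) / 2, (x - (5 * a + c) / 6) * f' x)
        + ∫ x in (a + c) / 2..c, (x - (a + 5 * c) / 6) * f' x) := by
  have parts : ∀ {u v : ℝ} (k : ℝ), u ≤ v → Icc u v ⊆ Icc a c →
      ∫ x in u..v, (x - k) * f' x
        = (v - k) * f v - (u - k) * f u - ∫ x in u..v, f x := by
    intro u v k huv hsub
    have hf' : IntervalIntegrable f' volume u v :=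
      hint.mono_set (by rwa [uIcc_of_le huv, uIcc_of_le hac.le])
    have := intervalIntegral.integral_mul_deriv_eq_deriv_mul (a := u) (b := v)
      (u := fun x => x - k) (u' := fun _ => 1) (v := f) (v' := f')
      (fun x _ => (hasDerivAt_id x).sub_const k)
      (fun x hx => hderiv x (hsub (by rwa [uIcc_of_le huv] at hx)))
      intervalIntegrable_const hf'
    simpa using this
  have hfint : ∀ {u v : ℝ}, u ≤ v → Icc u v ⊆ Icc a c → IntervalIntegrable f volume u v := by
    intro u v huv hsub
    refine ContinuousOn.intervalIntegrable fun x hx => ?_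
    rw [uIcc_of_le huv] at hx
    exact (hderiv x (hsub hx)).continuousAt.continuousWithinAt
  have h₁ : a ≤ (a + c) / 2 := by linarith
  have h₂ : (a + c) / 2 ≤ c := by linarith
  rw [parts _ h₁ (Icc_subset_Icc le_rfl h₂), parts _ h₂ (Icc_subset_Icc h₁ le_rfl),
    ← intervalIntegral.integral_add_adjacent_intervals
      (hfint h₁ (Icc_subset_Icc le_rfl h₂)) (hfint h₂ (Icc_subset_Icc h₁ le_rfl))]
  have : c - a ≠ 0 := by linarith
  field_simp
  ring

/-- Hölder's inequality for one half of the Peano kernel of Simpson's rule. -/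
lemma abs_integral_kernel_mul_le {g : ℝ → ℝ} {u v k h p q N K S : ℝ}
    (hpq : p.HolderConjugate q) (hh : 0 < h) (huk : u ≤ k) (hkv : k ≤ v)
    (hpow : (k - u) ^ (p + 1) + (v - k) ^ (p + 1) = (h / 6) ^ (p + 1) * (2 ^ (p + 1) + 1))
    (hg : IntervalIntegrable g volume u v) (hgN : ∀ x ∈ Icc u v, |g x| ≤ N)
    (hS : ∫ x in u..v, |g x| ^ q ≤ h / 2 * (K * S)) (hK : 0 < K) :
    |∫ x in u..v, (x - k) * g x|
      ≤ h * (h / 12 * ((2 ^ (p + 1) + 1) / (3 * (p + 1))) ^ (1 / p) * K ^ (1 / q)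
        * S ^ (1 / q)) := by
  have hp := hpq.pos
  have hq := hpq.symm.pos
  have huv := huk.trans hkv
  have hnn : 0 ≤ ∫ x in u..v, |g x| ^ q :=
    intervalIntegral.integral_nonneg huv fun x _ => by positivity
  have hS0 : 0 ≤ S := by
    by_contra! hneg
    have := mul_pos (half_pos hh) (mul_pos hK (neg_pos.2 hneg))
    linarith
  have hk : IntervalIntegrable (fun x : ℝ => x - k) volume u v :=
    (continuous_id.sub continuous_const).intervalIntegrable u v
  refine (abs_integral_mul_le_Lp_mul_Lq_of_bounded huv hpq (M := v - u) hk hg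
    (fun x hx => abs_le.2 ⟨by linarith [hx.1], by linarith [hx.2]⟩) hgN).trans ?_
  rw [integral_abs_sub_rpow huk hkv hp, hpow]
  have hkernel : (h / 6) ^ (p + 1) * (2 ^ (p + 1) + 1) / (p + 1)
      = (h / 6) ^ p * (h / 2) * ((2 ^ (p + 1) + 1) / (3 * (p + 1))) := by
    rw [rpow_add_one (by positivity : h / 6 ≠ 0)]
    field_simp
    ring
  have hhalf : (h / 2) ^ (1 / p) * (h / 2) ^ (1 / q) = h / 2 := by
    rw [← rpow_add (half_pos hh), one_div, one_div, hpq.inv_add_inv_eq_one, rpow_one]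
  rw [hkernel, mul_rpow (by positivity) (by positivity), mul_rpow (by positivity) (by positivity),
    ← rpow_mul (by positivity), mul_one_div_cancel hp.ne', rpow_one]
  calc _ ≤ h / 6 * (h / 2) ^ (1 / p) * ((2 ^ (p + 1) + 1) / (3 * (p + 1))) ^ (1 / p)
        * (h / 2 * (K * S)) ^ (1 / q) := by gcongr
    _ = h / 6 * ((h / 2) ^ (1 / p) * (h / 2) ^ (1 / q))
        * (((2 ^ (p + 1) + 1) / (3 * (p + 1))) ^ (1 / p) * K ^ (1 / q) * S ^ (1 / q)) := by
      rw [mul_rpow (by positivity) (by positivity), mul_rpow (by positivity) (by positivity)]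
      ring
    _ = _ := by rw [hhalf]; ring

lemma AlphaMConvexOn.le_chord {g : ℝ → ℝ} {a b m α x : ℝ} (hg : AlphaMConvexOn (Icc a b) α m g)
    (hab : a ≤ b) (hmb : a < m * b) (hx : x ∈ Icc a (m * b)) :
    g x ≤ ((m * b - x) / (m * b - a)) ^ α * g a
      + m * (1 - ((m * b - x) / (m * b - a)) ^ α) * g b := by
  have hh : 0 < m * b - a := sub_pos.2 hmb
  have := hg a (left_mem_Icc.2 hab) b (right_mem_Icc.2 hab) ((m * b - x) / (m * b - a))
    ⟨div_nonneg (by linarith [hx.2]) hh.le, (div_le_one hh).2 (by linarith [hx.1])⟩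
  convert this using 2
  field_simp
  ring

lemma AlphaMConvexOn.le_add {g : ℝ → ℝ} {a b m α x : ℝ} (hg : AlphaMConvexOn (Icc a b) α m g)
    (hab : a ≤ b) (hmb : a < m * b) (hα : 0 ≤ α) (hm : 0 ≤ m) (ha : 0 ≤ g a) (hb : 0 ≤ g b)
    (hx : x ∈ Icc a (m * b)) : g x ≤ g a + m * g b := by
  have hh : 0 < m * b - a := sub_pos.2 hmb
  have hs : 0 ≤ (m * b - x) / (m * b - a) := div_nonneg (by linarith [hx.2]) hh.le
  have hs₁ : ((m * b - x) / (m * b - a)) ^ α ≤ 1 :=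
    rpow_le_one hs ((div_le_one hh).2 (by linarith [hx.1])) hα
  refine (hg.le_chord hab hmb hx).trans ?_
  have := mul_le_mul_of_nonneg_right hs₁ ha
  have := mul_nonneg (rpow_nonneg hs α) (mul_nonneg hm hb)
  linarith

lemma AlphaMConvexOn.integral_le {g : ℝ → ℝ} {a b m α u v : ℝ}
    (hg : AlphaMConvexOn (Icc a b) α m g)
    (hab : a ≤ b) (hmb : a < m * b) (hα : 0 < α) (huv : u ≤ v) (hsub : Icc u v ⊆ Icc a (m * b))
    (hint : IntervalIntegrable g volume u v) :
    ∫ x in u..v, g x ≤ (v - u) * (m * g b) + (m * b - a) *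
      ((((m * b - u) / (m * b - a)) ^ (α + 1) - ((m * b - v) / (m * b - a)) ^ (α + 1)) / (α + 1))
        * (g a - m * g b) := by
  have hc : Continuous fun x : ℝ => ((m * b - x) / (m * b - a)) ^ α :=
    ((continuous_const.sub continuous_id).div_const _).rpow_const fun _ => Or.inr hα.le
  calc ∫ x in u..v, g x
      ≤ ∫ x in u..v, (m * g b + ((m * b - x) / (m * b - a)) ^ α * (g a - m * g b)) := by
        refine intervalIntegral.integral_mono_on huv hint
          ((continuous_const.add (hc.mul continuous_const)).intervalIntegrable u v) fun x hx => ?_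
        linarith [hg.le_chord hab hmb (hsub hx)]
    _ = _ := by
        rw [intervalIntegral.integral_add intervalIntegrable_const
          ((hc.intervalIntegrable u v).mul_const _),
          intervalIntegral.integral_const, intervalIntegral.integral_mul_const,
          integral_sub_div_rpow (sub_pos.2 hmb) hα, smul_eq_mul]

theorem simpson_holder_explicit (I : Set ℝ) (hI : I.OrdConnected) (hI0 : I ⊆ Ici (0:ℝ))
    (f f' : ℝ → ℝ) (a b m α p q : ℝ)
    (ha : a ∈ interior I) (hb : b ∈ interior I) (hab : a < b)
    (hα : α ∈ Ioc (0:ℝ) 1) (hm : m ∈ Ioc (0:ℝ) 1) (hmb : a < m * b)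
    (hq : 1 < q) (hpq : 1 / p + 1 / q = 1)
    (hdiff : ∀ x ∈ interior I, HasDerivAt f (f' x) x)
    (hint : IntervalIntegrable f' volume a b)
    (hconv : AlphaMConvexOn (Icc a b) α m (fun x => |f' x| ^ q))
    (A3 B3 : ℝ)
    (hA3 : A3 = |f' a| ^ q + m * (2 ^ α * (α + 1) - 1) * |f' b| ^ q)
    (hB3 : B3 = (2 ^ (α + 1) - 1) * |f' a| ^ q
        + m * (2 ^ α * (α + 1) + 1 - 2 ^ (α + 1)) * |f' b| ^ q) :
    |(1 / 6) * (f a + 4 * f ((a + m * b) / 2) + f (m * b))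
        - (1 / (m * b - a)) * ∫ x in a..(m * b), f x|
      ≤ ((m * b - a) / 12) * ((2 ^ (p + 1) + 1) / (3 * (p + 1))) ^ (1 / p) *
        (1 / (2 ^ α * (α + 1))) ^ (1 / q) * (A3 ^ (1 / q) + B3 ^ (1 / q)) := by
  have hpq' : p.HolderConjugate q := by
    have hq0 : 0 < q := by linarith
    refine (Real.holderConjugate_iff.2 ⟨hq, ?_⟩).symm
    rw [one_div, one_div] at hpq
    linarith
  have hp := hpq'.pos
  have hq0 := hpq'.symm.pos
  obtain ⟨hα0, hα1⟩ := hα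
  obtain ⟨hm0, hm1⟩ := hm
  have hb0 : 0 ≤ b := hI0 (interior_subset hb)
  have hcb : m * b ≤ b := mul_le_of_le_one_left hb0 hm1
  have hsub : Icc a (m * b) ⊆ interior I :=
    (Icc_subset_Icc le_rfl hcb).trans (hI.interior.out ha hb)
  have hbound : ∀ x ∈ Icc a (m * b), |f' x| ≤ (|f' a| ^ q + m * |f' b| ^ q) ^ (1 / q) := by
    intro x hx
    have := hconv.le_add hab.le hmb hα0.le hm0.le (by positivity) (by positivity) hx
    rw [one_div]
    exact (le_rpow_inv_iff_of_pos (abs_nonneg _) (by positivity) hq0).2 this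
  have hf'c : IntervalIntegrable f' volume a (m * b) :=
    hint.mono_set (by
      rw [uIcc_of_le hmb.le, uIcc_of_le hab.le]; exact Icc_subset_Icc le_rfl hcb)
  rw [simpson_sub_integral_eq hmb (fun x hx => hdiff x (hsub hx)) hf'c]
  set c := m * b with hc
  set h := c - a with hh
  have hh0 : 0 < h := sub_pos.2 hmb
  have h₁ : a ≤ (a + c) / 2 := by linarith
  have h₂ : (a + c) / 2 ≤ c := by linarith
  have hs₁ : Icc a ((a + c) / 2) ⊆ Icc a c := Icc_subset_Icc le_rfl h₂
  have hs₂ : Icc ((a + c) / 2) c ⊆ Icc a c := Icc_subset_Icc h₁ le_rfl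
  have hf'q : IntervalIntegrable (fun x => |f' x| ^ q) volume a c := by
    rw [intervalIntegrable_iff_integrableOn_Ioc_of_le hmb.le] at hf'c ⊢
    refine Integrable.of_bound (hf'c.aestronglyMeasurable.aemeasurable.abs.pow_const
      q).aestronglyMeasurable (|f' a| ^ q + m * |f' b| ^ q) ?_
    refine (ae_restrict_iff' measurableSet_Ioc).2 (Filter.Eventually.of_forall fun x hx => ?_)
    rw [norm_of_nonneg (by positivity)]
    exact hconv.le_add hab.le hmb hα0.le hm0.le (by positivity) (by positivity)
      (Ioc_subset_Icc_self hx)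
  have hmono : ∀ {w : ℝ → ℝ} {u v : ℝ}, IntervalIntegrable w volume a c → u ≤ v →
      Icc u v ⊆ Icc a c → IntervalIntegrable w volume u v := fun hw huv hs =>
    hw.mono_set (by rwa [uIcc_of_le huv, uIcc_of_le hmb.le])
  have hsα : ((c - (a + c) / 2) / h) ^ (α + 1) = 1 / (2 * 2 ^ α) := by
    rw [show (c - (a + c) / 2) / h = (2 : ℝ)⁻¹ by
        rw [show c - (a + c) / 2 = h / 2 by rw [hh]; ring]
        field_simp,
      inv_rpow zero_le_two, rpow_add_one two_ne_zero, one_div, mul_comm]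
  have hα2 : (2 : ℝ) ^ (α + 1) = 2 ^ α * 2 := rpow_add_one two_ne_zero α
  have h2α : (0 : ℝ) < 2 ^ α := by positivity
  have hS₁ : ∫ x in a..(a + c) / 2, |f' x| ^ q
      ≤ h / 2 * (1 / (2 ^ α * (α + 1)) * B3) := by
    refine (hconv.integral_le hab.le hmb hα0 h₁ hs₁ (hmono hf'q h₁ hs₁)).trans_eq ?_
    rw [← hc, ← hh, hsα, div_self hh0.ne', one_rpow, hB3, hα2,
      show (a + c) / 2 - a = h / 2 by rw [hh]; ring]
    field_simp
    ring
  have hS₂ : ∫ x in (a + c) / 2..c, |f' x| ^ q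
      ≤ h / 2 * (1 / (2 ^ α * (α + 1)) * A3) := by
    refine (hconv.integral_le hab.le hmb hα0 h₂ hs₂ (hmono hf'q h₂ hs₂)).trans_eq ?_
    rw [← hc, ← hh, hsα, sub_self, zero_div, zero_rpow (by linarith), hA3,
      show c - (a + c) / 2 = h / 2 by rw [hh]; ring]
    field_simp
    ring
  have hthird : (h / 3) ^ (p + 1) = (h / 6) ^ (p + 1) * 2 ^ (p + 1) := by
    rw [← mul_rpow (by positivity) zero_le_two]
    ring_nf
  have hK : 0 < 1 / (2 ^ α * (α + 1)) := by positivity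
  have e₁ := abs_integral_kernel_mul_le (k := (5 * a + c) / 6) hpq' hh0
    (by linarith) (by linarith)
    (by
      rw [show (5 * a + c) / 6 - a = h / 6 by rw [hh]; ring,
        show (a + c) / 2 - (5 * a + c) / 6 = h / 3 by rw [hh]; ring, hthird]
      ring)
    (hmono hf'c h₁ hs₁) (fun x hx => hbound x (hs₁ hx)) hS₁ hK
  have e₂ := abs_integral_kernel_mul_le (k := (a + 5 * c) / 6) hpq' hh0
    (by linarith) (by linarith)
    (by
      rw [show (a + 5 * c) / 6 - (a + c) / 2 = h / 3 by rw [hh]; ring,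
        show c - (a + 5 * c) / 6 = h / 6 by rw [hh]; ring, hthird]
      ring)
    (hmono hf'c h₂ hs₂) (fun x hx => hbound x (hs₂ hx)) hS₂ hK
  rw [abs_mul, abs_of_pos (one_div_pos.2 hh0), one_div_mul_eq_div, div_le_iff₀ hh0]
  refine (abs_add_le _ _).trans ((add_le_add e₁ e₂).trans_eq ?_)
  ring
end

section
/- Let f : I ⊆ [0,∞) → ℝ be differentiable on I° with f' integrable on [a,b], where a,b ∈ I° with a < b, and suppose |f'|^q is (α,m)-convex on [a,b] for (α,m) ∈ (0,1]² with mb > a, where q > 1 and 1/p + 1/q = 1. With A₃ = |f'(a)|^q + m[2^α(α+1) − 1]|f'(b)|^q and B₃ = (2^{α+1} − 1)|f'(a)|^q + m[2^α(α+1) + 1 − 2^{α+1}]|f'(b)|^q, we have |(f(a)+f(mb))/2 − (1/(mb−a)) ∫ₐ^{mb} f(x) dx| ≤ ((mb−a)/4)(1/(p+1))^{1/p} (1/(2^α(α+1)))^{1/q} (A₃^{1/q} + B₃^{1/q}). -/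
open MeasureTheory Set Real

/-- Hölder's inequality on an interval, with a continuous majorant `G` of `|h| ^ q`. -/
theorem abs_intervalIntegral_mul_le_of_rpow_le {p q u v : ℝ} (hpq : p.HolderConjugate q)
    (huv : u ≤ v) {w h G : ℝ → ℝ} (hw : Continuous w) (hh : IntervalIntegrable h volume u v)
    (hG : Continuous G) (hle : ∀ t ∈ Icc u v, |h t| ^ q ≤ G t) :
    |∫ t in u..v, w t * h t|
      ≤ (∫ t in u..v, |w t| ^ p) ^ (1 / p) * (∫ t in u..v, G t) ^ (1 / q) := by
  have hq : 0 < q := hpq.symm.pos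
  have hq1 : 0 ≤ 1 / q := by positivity
  have hmeas : AEStronglyMeasurable h (volume.restrict (Ioc u v)) :=
    ((intervalIntegrable_iff_integrableOn_Ioc_of_le huv).1 hh).aestronglyMeasurable
  obtain ⟨C, hC⟩ := (isCompact_Icc (a := u) (b := v)).exists_bound_of_continuousOn hG.continuousOn
  obtain ⟨D, hD⟩ := (isCompact_Icc (a := u) (b := v)).exists_bound_of_continuousOn hw.continuousOn
  have hbound : ∀ t ∈ Icc u v, |h t| ≤ C ^ (1 / q) := fun t ht => by
    have h1 : |h t| ^ q ≤ C := (hle t ht).trans ((le_abs_self _).trans (hC t ht))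
    calc |h t| = (|h t| ^ q) ^ (1 / q) := by
          rw [one_div, Real.rpow_rpow_inv (abs_nonneg _) hq.ne']
      _ ≤ C ^ (1 / q) := Real.rpow_le_rpow (by positivity) h1 hq1
  have hwL : ∀ r, MemLp (fun t => |w t|) r (volume.restrict (Ioc u v)) := fun r =>
    MemLp.of_bound hw.abs.aestronglyMeasurable D <|
      (ae_restrict_mem measurableSet_Ioc).mono fun t ht => by
        simpa using hD t (Ioc_subset_Icc_self ht)
  have hhL : ∀ r, MemLp (fun t => |h t|) r (volume.restrict (Ioc u v)) := fun r =>
    MemLp.of_bound hmeas.norm (C ^ (1 / q)) <|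
      (ae_restrict_mem measurableSet_Ioc).mono fun t ht => by
        simpa using hbound t (Ioc_subset_Icc_self ht)
  have hint : IntegrableOn (fun t => |h t| ^ q) (Ioc u v) := by
    simpa [IntegrableOn, ENNReal.toReal_ofReal hq.le] using
      (hhL (ENNReal.ofReal q)).integrable_norm_rpow (by simpa using hq) ENNReal.ofReal_ne_top
  have hmono : ∫ t in u..v, |h t| ^ q ≤ ∫ t in u..v, G t :=
    intervalIntegral.integral_mono_on huv
      ((intervalIntegrable_iff_integrableOn_Ioc_of_le huv).2 hint)
      (hG.intervalIntegrable _ _) hle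
  have hnonneg : 0 ≤ ∫ t in u..v, |h t| ^ q :=
    intervalIntegral.integral_nonneg huv fun t _ => by positivity
  have hnonneg' : 0 ≤ ∫ t in u..v, |w t| ^ p :=
    intervalIntegral.integral_nonneg huv fun t _ => by positivity
  calc |∫ t in u..v, w t * h t| ≤ ∫ t in u..v, |w t * h t| :=
        intervalIntegral.abs_integral_le_integral_abs huv
    _ = ∫ t in u..v, |w t| * |h t| := by simp only [abs_mul]
    _ ≤ (∫ t in u..v, |w t| ^ p) ^ (1 / p) * (∫ t in u..v, |h t| ^ q) ^ (1 / q) := by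
        simp only [intervalIntegral.integral_of_le huv]
        exact integral_mul_le_Lp_mul_Lq_of_nonneg hpq (ae_of_all _ fun t => abs_nonneg _)
          (ae_of_all _ fun t => abs_nonneg _) (hwL _) (hhL _)
    _ ≤ _ := by gcongr

theorem integral_zero_half_abs_one_sub_two_mul_rpow {p : ℝ} (hp : 0 < p) :
    ∫ t in (0:ℝ)..(1 / 2), |1 - 2 * t| ^ p = 1 / 2 * (1 / (p + 1)) := by
  rw [intervalIntegral.integral_comp_sub_mul (fun x => |x| ^ p) two_ne_zero 1]
  have h : ∫ x in (1 - 2 * (1 / 2) : ℝ)..(1 - 2 * 0), |x| ^ p = ∫ x in (0:ℝ)..1, x ^ p := by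
    norm_num
    refine intervalIntegral.integral_congr fun x hx => ?_
    rw [uIcc_of_le zero_le_one] at hx
    simp only [abs_of_nonneg hx.1]
  rw [h, integral_rpow (Or.inl (by linarith)), Real.zero_rpow (by linarith), Real.one_rpow]
  simp

theorem integral_half_one_abs_one_sub_two_mul_rpow {p : ℝ} (hp : 0 < p) :
    ∫ t in (1 / 2 : ℝ)..1, |1 - 2 * t| ^ p = 1 / 2 * (1 / (p + 1)) := by
  rw [← integral_zero_half_abs_one_sub_two_mul_rpow hp]
  have h := intervalIntegral.integral_comp_sub_left (a := 1 / 2) (b := 1)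
    (fun t => |1 - 2 * t| ^ p) (1:ℝ)
  norm_num at h ⊢
  rw [← h]
  refine intervalIntegral.integral_congr fun t _ => ?_
  rw [← abs_neg]
  ring_nf

theorem integral_rpow_mul_add_one_sub_rpow_mul {α : ℝ} (hα : 0 < α) (X Y u v : ℝ) :
    ∫ t in u..v, (t ^ α * X + (1 - t ^ α) * Y)
      = (v ^ (α + 1) - u ^ (α + 1)) / (α + 1) * (X - Y) + (v - u) * Y := by
  have h : ∀ t : ℝ, t ^ α * X + (1 - t ^ α) * Y = t ^ α * (X - Y) + Y := fun t => by ring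
  simp only [h]
  rw [intervalIntegral.integral_add, intervalIntegral.integral_mul_const,
    integral_rpow (Or.inl (by linarith)), intervalIntegral.integral_const, smul_eq_mul]
  · exact ((Real.continuous_rpow_const hα.le).mul continuous_const).intervalIntegrable _ _
  · exact intervalIntegrable_const

/-- The weighted-derivative representation of the error of the trapezoid rule. -/
theorem trapezoid_error_eq_integral {f f' : ℝ → ℝ} {a c : ℝ} (hac : a < c)
    (hdiff : ∀ x ∈ Icc a c, HasDerivAt f (f' x) x) (hint : IntervalIntegrable f' volume a c) :
    (f a + f c) / 2 - (1 / (c - a)) * ∫ x in a..c, f x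
      = (c - a) / 2 * ∫ t in (0:ℝ)..1, (1 - 2 * t) * f' ((a - c) * t + c) := by
  have hk : a - c ≠ 0 := by linarith
  have hk' : c - a ≠ 0 := by linarith
  have hg := intervalIntegral.integral_comp_mul_add (a := 0) (b := 1)
    (fun x => (x - (a + c) / 2) * f' x) hk c
  have hparts := intervalIntegral.integral_mul_deriv_eq_deriv_mul (a := a) (b := c)
    (u := fun x => x - (a + c) / 2) (u' := fun _ => 1) (v := f) (v' := f')
    (fun x _ => (hasDerivAt_id x).sub_const _)
    (fun x hx => hdiff x (by rwa [uIcc_of_le hac.le] at hx))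
    intervalIntegrable_const hint
  have hw : ∀ t, (1 - 2 * t) * f' ((a - c) * t + c)
      = 2 / (c - a) * (((a - c) * t + c - (a + c) / 2) * f' ((a - c) * t + c)) := fun t => by
    field_simp
    ring
  simp only [hw]
  rw [intervalIntegral.integral_const_mul, hg, mul_zero, zero_add, mul_one, sub_add_cancel,
    intervalIntegral.integral_symm a c, hparts, smul_eq_mul, ← neg_sub c a]
  simp only [one_mul]
  field_simp
  ring


theorem trapezoid_holder_explicit (I : Set ℝ) (hI : I.OrdConnected) (hI0 : I ⊆ Ici (0:ℝ))
    (f f' : ℝ → ℝ) (a b m α p q : ℝ)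
    (ha : a ∈ interior I) (hb : b ∈ interior I) (hab : a < b)
    (hα : α ∈ Ioc (0:ℝ) 1) (hm : m ∈ Ioc (0:ℝ) 1) (hmb : a < m * b)
    (hq : 1 < q) (hpq : 1 / p + 1 / q = 1)
    (hdiff : ∀ x ∈ interior I, HasDerivAt f (f' x) x)
    (hint : IntervalIntegrable f' volume a b)
    (hconv : AlphaMConvexOn (Icc a b) α m (fun x => |f' x| ^ q))
    (A3 B3 : ℝ)
    (hA3 : A3 = |f' a| ^ q + m * (2 ^ α * (α + 1) - 1) * |f' b| ^ q)
    (hB3 : B3 = (2 ^ (α + 1) - 1) * |f' a| ^ q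
        + m * (2 ^ α * (α + 1) + 1 - 2 ^ (α + 1)) * |f' b| ^ q) :
    |(f a + f (m * b)) / 2 - (1 / (m * b - a)) * ∫ x in a..(m * b), f x|
      ≤ ((m * b - a) / 4) * (1 / (p + 1)) ^ (1 / p) *
        (1 / (2 ^ α * (α + 1))) ^ (1 / q) * (A3 ^ (1 / q) + B3 ^ (1 / q)) := by
  have hp : p.HolderConjugate q := by
    have hq0 : 0 < q := by linarith
    refine (Real.holderConjugate_iff.2 ⟨hq, ?_⟩).symm
    rw [one_div, one_div] at hpq
    linarith
  have ha0 : 0 ≤ a := hI0 (interior_subset ha)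
  have hmb_le : m * b ≤ b := by nlinarith [hm.2]
  have hsub : Icc a (m * b) ⊆ interior I := (Icc_subset_Icc_right hmb_le).trans
    (hI.interior.out ha hb)
  have hint' : IntervalIntegrable f' volume a (m * b) := hint.mono_set (by
    rw [uIcc_of_le hmb.le, uIcc_of_le hab.le]
    exact Icc_subset_Icc_right hmb_le)
  rw [trapezoid_error_eq_integral hmb (fun x hx => hdiff x (hsub hx)) hint']
  set h : ℝ → ℝ := fun t => f' ((a - m * b) * t + m * b)
  have hk : a - m * b ≠ 0 := by linarith
  have hhint : IntervalIntegrable h volume 0 1 := by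
    have h1 := (hint'.symm.comp_add_right (m * b)).comp_mul_left (c := a - m * b)
    simpa [hk, div_self hk] using h1
  have hhint₁ : IntervalIntegrable h volume 0 (1 / 2) := hhint.mono_set (by
    rw [uIcc_of_le (by norm_num), uIcc_of_le zero_le_one]
    exact Icc_subset_Icc_right (by norm_num))
  have hhint₂ : IntervalIntegrable h volume (1 / 2) 1 := hhint.mono_set (by
    rw [uIcc_of_le (by norm_num), uIcc_of_le zero_le_one]
    exact Icc_subset_Icc_left (by norm_num))
  set X := |f' a| ^ q
  set Y := |f' b| ^ q
  set G : ℝ → ℝ := fun t => t ^ α * X + (1 - t ^ α) * (m * Y) with hGdef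
  have hGcont : Continuous G := by
    have := Real.continuous_rpow_const hα.1.le
    fun_prop
  have hle : ∀ t ∈ Icc (0:ℝ) 1, |h t| ^ q ≤ G t := fun t ht => by
    have h1 := hconv a (left_mem_Icc.2 hab.le) b (right_mem_Icc.2 hab.le) t ht
    have h2 : t * a + m * (1 - t) * b = (a - m * b) * t + m * b := by ring
    simp only [h2] at h1
    refine h1.trans_eq ?_
    simp only [hGdef]
    ring
  have hle₁ : ∀ t ∈ Icc (0:ℝ) (1 / 2), |h t| ^ q ≤ G t := fun t ht =>
    hle t ⟨ht.1, ht.2.trans (by norm_num)⟩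
  have hle₂ : ∀ t ∈ Icc (1 / 2 : ℝ) 1, |h t| ^ q ≤ G t := fun t ht =>
    hle t ⟨le_trans (by norm_num) ht.1, ht.2⟩
  have hw : Continuous fun t : ℝ => 1 - 2 * t := by fun_prop
  have H₁ := abs_intervalIntegral_mul_le_of_rpow_le hp (by norm_num) hw hhint₁ hGcont hle₁
  have H₂ := abs_intervalIntegral_mul_le_of_rpow_le hp (by norm_num) hw hhint₂ hGcont hle₂
  have hG₁ : 0 ≤ ∫ t in (0:ℝ)..(1 / 2), G t := intervalIntegral.integral_nonneg (by norm_num)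
    fun t ht => le_trans (by positivity) (hle₁ t ht)
  have hG₂ : 0 ≤ ∫ t in (1 / 2 : ℝ)..1, G t := intervalIntegral.integral_nonneg (by norm_num)
    fun t ht => le_trans (by positivity) (hle₂ t ht)
  rw [integral_zero_half_abs_one_sub_two_mul_rpow hp.pos] at H₁
  rw [integral_half_one_abs_one_sub_two_mul_rpow hp.pos] at H₂
  have hα0 := hα.1
  have hhalf : (1 / 2 : ℝ) ^ (α + 1) = 1 / (2 * 2 ^ α) := by
    rw [one_div, Real.inv_rpow zero_le_two, Real.rpow_add_one two_ne_zero]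
    ring
  have h2α1 : (2:ℝ) ^ (α + 1) = 2 * 2 ^ α := by
    rw [Real.rpow_add_one two_ne_zero, mul_comm]
  have hI₁ : ∫ t in (0:ℝ)..(1 / 2), G t = 1 / 2 * (1 / (2 ^ α * (α + 1)) * A3) := by
    rw [integral_rpow_mul_add_one_sub_rpow_mul hα0, hhalf, Real.zero_rpow (by linarith), hA3]
    field_simp
    ring
  have hI₂ : ∫ t in (1 / 2 : ℝ)..1, G t = 1 / 2 * (1 / (2 ^ α * (α + 1)) * B3) := by
    rw [integral_rpow_mul_add_one_sub_rpow_mul hα0, hhalf, Real.one_rpow, hB3, h2α1]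
    field_simp
    ring
  have hD : (0:ℝ) < 1 / (2 ^ α * (α + 1)) := by positivity
  have hA : 0 ≤ A3 := by
    rw [hI₁] at hG₁
    exact nonneg_of_mul_nonneg_right (nonneg_of_mul_nonneg_right hG₁ (by norm_num)) hD
  have hB : 0 ≤ B3 := by
    rw [hI₂] at hG₂
    exact nonneg_of_mul_nonneg_right (nonneg_of_mul_nonneg_right hG₂ (by norm_num)) hD
  have hp0 := hp.pos
  have hprod : ((1:ℝ) / 2) ^ (1 / p) * (1 / 2) ^ (1 / q) = 1 / 2 := by
    rw [← Real.rpow_add (by norm_num), hpq, Real.rpow_one]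
  have key : ∀ S : ℝ, 0 ≤ S → (1 / 2 * (1 / (p + 1))) ^ (1 / p)
      * (1 / 2 * (1 / (2 ^ α * (α + 1)) * S)) ^ (1 / q)
      = 1 / 2 * ((1 / (p + 1)) ^ (1 / p) * (1 / (2 ^ α * (α + 1))) ^ (1 / q) * S ^ (1 / q)) := by
    intro S hS
    rw [Real.mul_rpow (by norm_num) (by positivity), Real.mul_rpow (by norm_num) (by positivity),
      Real.mul_rpow hD.le hS]
    linear_combination (1 / (p + 1)) ^ (1 / p) * (1 / (2 ^ α * (α + 1))) ^ (1 / q)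
      * S ^ (1 / q) * hprod
  rw [hI₁, key A3 hA] at H₁
  rw [hI₂, key B3 hB] at H₂
  have hsplit : ∫ t in (0:ℝ)..1, (1 - 2 * t) * h t
      = (∫ t in (0:ℝ)..(1 / 2), (1 - 2 * t) * h t) + ∫ t in (1 / 2 : ℝ)..1, (1 - 2 * t) * h t :=
    (intervalIntegral.integral_add_adjacent_intervals
      (hhint₁.continuousOn_mul hw.continuousOn) (hhint₂.continuousOn_mul hw.continuousOn)).symm
  have hpos : 0 ≤ (m * b - a) / 2 := by linarith
  rw [hsplit, abs_mul, abs_of_nonneg hpos]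
  refine (mul_le_mul_of_nonneg_left ((abs_add_le _ _).trans (add_le_add H₁ H₂)) hpos).trans_eq ?_
  ring
end

section
/- Let f : I ⊆ [0,∞) → ℝ be differentiable on I° with f' integrable on [a,b], where a,b ∈ I° with a < b, and suppose |f'|^q is (α,m)-convex on [a,b] for (α,m) ∈ (0,1]² with mb > a, where q > 1 and 1/p + 1/q = 1. With A₃ = |f'(a)|^q + m[2^α(α+1) − 1]|f'(b)|^q and B₃ = (2^{α+1} − 1)|f'(a)|^q + m[2^α(α+1) + 1 − 2^{α+1}]|f'(b)|^q, we have |f((a+mb)/2) − (1/(mb−a)) ∫ₐ^{mb} f(x) dx| ≤ ((mb−a)/4)(1/(p+1))^{1/p} (1/(2^α(α+1)))^{1/q} (A₃^{1/q} + B₃^{1/q}). -/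
open MeasureTheory Set Real

/-- Hölder's inequality on an interval, for a product whose second factor is dominated by
a continuous function. -/
lemma abs_integral_mul_le_of_abs_rpow_le {l r p q : ℝ} (hlr : l ≤ r) (hpq : p.HolderConjugate q)
    {w g φ : ℝ → ℝ} (hw : Continuous w) (hg : Continuous g)
    (hφ : ∀ x ∈ Icc l r, |φ x| ^ q ≤ g x) :
    |∫ x in l..r, w x * φ x|
      ≤ (∫ x in l..r, |w x| ^ p) ^ (1 / p) * (∫ x in l..r, g x) ^ (1 / q) := by
  have hq := hpq.symm.pos
  have hG : Continuous fun x => g x ^ (1 / q) :=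
    hg.rpow_const fun x => Or.inr (by positivity)
  have hg0 : ∀ x ∈ Icc l r, 0 ≤ g x := fun x hx => le_trans (by positivity) (hφ x hx)
  have hφG : ∀ x ∈ Icc l r, |φ x| ≤ g x ^ (1 / q) := fun x hx => by
    have h := Real.rpow_le_rpow (by positivity) (hφ x hx) (one_div_nonneg.2 hq.le)
    rwa [← Real.rpow_mul (abs_nonneg _), mul_one_div_cancel hq.ne', Real.rpow_one] at h
  have hmem : ∀ {h : ℝ → ℝ}, Continuous h → ∀ s, MemLp h s (volume.restrict (Ioc l r)) := by
    intro h hh s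
    obtain ⟨C, hC⟩ := isCompact_Icc.exists_bound_of_continuousOn (hh.continuousOn (s := Icc l r))
    refine MemLp.of_bound hh.aestronglyMeasurable C ?_
    exact (ae_restrict_mem measurableSet_Ioc).mono fun x hx => hC x (Ioc_subset_Icc_self hx)
  calc |∫ x in l..r, w x * φ x|
      ≤ ∫ x in l..r, |w x| * g x ^ (1 / q) := by
        rw [← Real.norm_eq_abs]
        refine intervalIntegral.norm_integral_le_of_norm_le hlr (ae_of_all _ fun x hx => ?_)
          (Continuous.intervalIntegrable (hw.abs.mul hG) _ _)
        rw [Real.norm_eq_abs, abs_mul]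
        exact mul_le_mul_of_nonneg_left (hφG x (Ioc_subset_Icc_self hx)) (abs_nonneg _)
    _ ≤ (∫ x in l..r, |w x| ^ p) ^ (1 / p)
          * (∫ x in l..r, (g x ^ (1 / q)) ^ q) ^ (1 / q) := by
        simp only [intervalIntegral.integral_of_le hlr]
        refine integral_mul_le_Lp_mul_Lq_of_nonneg hpq (ae_of_all _ fun x => abs_nonneg _) ?_
          (hmem hw.abs _) (hmem hG _)
        exact (ae_restrict_mem measurableSet_Ioc).mono fun x hx =>
          Real.rpow_nonneg (hg0 x (Ioc_subset_Icc_self hx)) _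
    _ = _ := by
        congr 2
        refine intervalIntegral.integral_congr fun x hx => ?_
        rw [uIcc_of_le hlr] at hx
        rw [← Real.rpow_mul (hg0 x hx), one_div_mul_cancel hq.ne', Real.rpow_one]

/-- Integration by parts of the midpoint rule against the Peano kernel. -/
lemma midpoint_sub_average_eq {f f' : ℝ → ℝ} {a c : ℝ} (hac : a < c)
    (hf : ∀ x ∈ Icc a c, HasDerivAt f (f' x) x) (hint : IntervalIntegrable f' volume a c) :
    f ((a + c) / 2) - (1 / (c - a)) * ∫ x in a..c, f x
      = (1 / (c - a)) * ((∫ x in a..(a + c) / 2, (x - a) * f' x)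
          + ∫ x in (a + c) / 2..c, (x - c) * f' x) := by
  have ha : a ≤ (a + c) / 2 := by linarith
  have hc : (a + c) / 2 ≤ c := by linarith
  have hfi : IntervalIntegrable f volume a c := ContinuousOn.intervalIntegrable fun x hx =>
    (hf x (by rwa [uIcc_of_le hac.le] at hx)).continuousAt.continuousWithinAt
  have hs₁ : uIcc a ((a + c) / 2) ⊆ uIcc a c := by
    rw [uIcc_of_le ha, uIcc_of_le hac.le]; exact Icc_subset_Icc_right hc
  have hs₂ : uIcc ((a + c) / 2) c ⊆ uIcc a c := by
    rw [uIcc_of_le hc, uIcc_of_le hac.le]; exact Icc_subset_Icc_left ha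
  have hf' : ∀ x ∈ uIcc a c, HasDerivAt f (f' x) x := by rwa [uIcc_of_le hac.le]
  have h₁ := intervalIntegral.integral_mul_deriv_eq_deriv_mul
    (fun x _ => (hasDerivAt_id x).sub_const a) (fun x hx => hf' x (hs₁ hx))
    intervalIntegrable_const (hint.mono_set hs₁)
  have h₂ := intervalIntegral.integral_mul_deriv_eq_deriv_mul
    (fun x _ => (hasDerivAt_id x).sub_const c) (fun x hx => hf' x (hs₂ hx))
    intervalIntegrable_const (hint.mono_set hs₂)
  have hadd := intervalIntegral.integral_add_adjacent_intervals
    (hfi.mono_set hs₁) (hfi.mono_set hs₂)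
  simp only [id, one_mul, sub_self, zero_mul] at h₁ h₂
  rw [h₁, h₂, ← hadd]
  have : c - a ≠ 0 := by linarith
  field_simp
  ring

lemma integral_zero_rpow {h s : ℝ} (hs : 0 < s) :
    ∫ x in (0:ℝ)..h, x ^ s = h ^ (s + 1) / (s + 1) := by
  rw [integral_rpow (Or.inl (by linarith)), Real.zero_rpow (by linarith), sub_zero]

/-- The Hölder bound on one half of the midpoint rule, for intervals of length `h`. -/
lemma abs_integral_mul_le_of_integral_eq {l r h p q K : ℝ} (hh : 0 < h) (hr : r = l + h)
    (hpq : p.HolderConjugate q) {w g φ : ℝ → ℝ} (hw : Continuous w) (hg : Continuous g)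
    (hφ : ∀ x ∈ Icc l r, |φ x| ^ q ≤ g x)
    (hwp : ∫ x in l..r, |w x| ^ p = h ^ (p + 1) / (p + 1))
    (hgK : ∫ x in l..r, g x = h * K) :
    0 ≤ K ∧ |∫ x in l..r, w x * φ x| ≤ h ^ 2 * (1 / (p + 1)) ^ (1 / p) * K ^ (1 / q) := by
  have hlr : l ≤ r := by linarith
  have hp := hpq.pos
  have hK : 0 ≤ K := by
    have : 0 ≤ ∫ x in l..r, g x := intervalIntegral.integral_nonneg hlr fun x hx =>
      le_trans (by positivity) (hφ x hx)
    rw [hgK] at this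
    exact nonneg_of_mul_nonneg_right this hh
  refine ⟨hK, (abs_integral_mul_le_of_abs_rpow_le hlr hpq hw hg hφ).trans_eq ?_⟩
  rw [hwp, hgK, div_eq_mul_one_div, Real.mul_rpow (by positivity) (by positivity),
    Real.mul_rpow hh.le hK, ← Real.rpow_mul hh.le]
  have he : (p + 1) * (1 / p) + 1 / q = 2 := by
    have := hpq.inv_add_inv_eq_one
    rw [add_mul, mul_one_div_cancel hp.ne', one_mul, add_assoc, one_div, one_div, this]
    norm_num
  have hsq : h ^ 2 = h ^ ((p + 1) * (1 / p)) * h ^ (1 / q) := by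
    rw [← Real.rpow_add hh, he, Real.rpow_two]
  rw [hsq]
  ring

/-- The integral of an affine function of `((c - x) / L) ^ α`. -/
lemma integral_affine_rpow {l r c L α u v : ℝ} (hα : 0 < α) (hL : 0 < L) :
    ∫ x in l..r, (((c - x) / L) ^ α * u + (1 - ((c - x) / L) ^ α) * v)
      = L * (((c - l) / L) ^ (α + 1) - ((c - r) / L) ^ (α + 1)) / (α + 1) * (u - v)
        + (r - l) * v := by
  have hc : Continuous fun x : ℝ => ((c - x) / L) ^ α :=
    (by fun_prop : Continuous fun x : ℝ => (c - x) / L).rpow_const fun _ => Or.inr hα.le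
  have hi : ∫ x in l..r, ((c - x) / L) ^ α
      = L * (((c - l) / L) ^ (α + 1) - ((c - r) / L) ^ (α + 1)) / (α + 1) := by
    have h := intervalIntegral.integral_comp_sub_left (a := l) (b := r)
      (fun y => (y / L) ^ α) c
    rw [h, intervalIntegral.integral_comp_div (fun y => y ^ α) hL.ne',
      integral_rpow (Or.inl (by linarith)), smul_eq_mul, mul_div_assoc]
  have he : ∀ x, ((c - x) / L) ^ α * u + (1 - ((c - x) / L) ^ α) * v
      = ((c - x) / L) ^ α * (u - v) + v := fun x => by ring
  simp only [he]
  have hcu : Continuous fun x : ℝ => ((c - x) / L) ^ α * (u - v) := hc.mul continuous_const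
  rw [intervalIntegral.integral_add (hcu.intervalIntegrable _ _) intervalIntegrable_const,
    intervalIntegral.integral_mul_const, hi,
    intervalIntegral.integral_const, smul_eq_mul]

theorem midpoint_holder_explicit (I : Set ℝ) (hI : I.OrdConnected) (hI0 : I ⊆ Ici (0:ℝ))
    (f f' : ℝ → ℝ) (a b m α p q : ℝ)
    (ha : a ∈ interior I) (hb : b ∈ interior I) (hab : a < b)
    (hα : α ∈ Ioc (0:ℝ) 1) (hm : m ∈ Ioc (0:ℝ) 1) (hmb : a < m * b)
    (hq : 1 < q) (hpq : 1 / p + 1 / q = 1)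
    (hdiff : ∀ x ∈ interior I, HasDerivAt f (f' x) x)
    (hint : IntervalIntegrable f' volume a b)
    (hconv : AlphaMConvexOn (Icc a b) α m (fun x => |f' x| ^ q))
    (A3 B3 : ℝ)
    (hA3 : A3 = |f' a| ^ q + m * (2 ^ α * (α + 1) - 1) * |f' b| ^ q)
    (hB3 : B3 = (2 ^ (α + 1) - 1) * |f' a| ^ q
        + m * (2 ^ α * (α + 1) + 1 - 2 ^ (α + 1)) * |f' b| ^ q) :
    |f ((a + m * b) / 2) - (1 / (m * b - a)) * ∫ x in a..(m * b), f x|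
      ≤ ((m * b - a) / 4) * (1 / (p + 1)) ^ (1 / p) *
        (1 / (2 ^ α * (α + 1))) ^ (1 / q) * (A3 ^ (1 / q) + B3 ^ (1 / q)) := by
  obtain ⟨hα0, -⟩ := hα
  obtain ⟨hm0, hm1⟩ := hm
  have hHC : p.HolderConjugate q := by
    refine (Real.holderConjugate_iff.2 ⟨hq, ?_⟩).symm
    rw [← one_div, ← one_div, add_comm, hpq]
  have hp := hHC.pos
  have ha0 : 0 ≤ a := hI0 (interior_subset ha)
  have hcb : m * b ≤ b := mul_le_of_le_one_left (by linarith) hm1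
  have hsub : Icc a (m * b) ⊆ interior I :=
    (Icc_subset_Icc_right hcb).trans (hI.interior.out ha hb)
  have hintc : IntervalIntegrable f' volume a (m * b) := hint.mono_set (by
    rw [uIcc_of_le hmb.le, uIcc_of_le hab.le]; exact Icc_subset_Icc_right hcb)
  rw [midpoint_sub_average_eq hmb (fun x hx => hdiff x (hsub hx)) hintc]
  set c := m * b with hc
  have hL : 0 < c - a := by linarith
  have hh : 0 < (c - a) / 2 := by linarith
  set u := |f' a| ^ q
  set v := |f' b| ^ q
  set g : ℝ → ℝ := fun x =>
    ((c - x) / (c - a)) ^ α * u + (1 - ((c - x) / (c - a)) ^ α) * (m * v) with hg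
  have hgc : Continuous g := by
    have : Continuous fun x : ℝ => ((c - x) / (c - a)) ^ α :=
      (by fun_prop : Continuous fun x : ℝ => (c - x) / (c - a)).rpow_const
        fun _ => Or.inr hα0.le
    fun_prop
  have hφ : ∀ x ∈ Icc a c, |f' x| ^ q ≤ g x := by
    intro x hx
    have h := hconv a (left_mem_Icc.2 hab.le) b (right_mem_Icc.2 hab.le) ((c - x) / (c - a))
      ⟨div_nonneg (by linarith [hx.2]) hL.le, (div_le_one hL).2 (by linarith [hx.1])⟩
    have hx' : (c - x) / (c - a) * a + m * (1 - (c - x) / (c - a)) * b = x := by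
      have : m * (1 - (c - x) / (c - a)) * b = (1 - (c - x) / (c - a)) * c := by rw [hc]; ring
      rw [this]
      field_simp
      ring
    simp only [hx'] at h
    exact h.trans_eq (by simp only [hg]; ring)
  have h2 : (2:ℝ) ^ (α + 1) = 2 * 2 ^ α := by rw [Real.rpow_add_one two_ne_zero, mul_comm]
  have h2α : (0:ℝ) < 2 ^ α := by positivity
  have hhalf : (1 / 2 : ℝ) ^ (α + 1) = 1 / (2 * 2 ^ α) := by
    rw [Real.div_rpow zero_le_one zero_le_two, Real.one_rpow, h2]
  have hα1 : α + 1 ≠ 0 := by linarith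
  have e₀ : (c - a) / (c - a) = 1 := div_self hL.ne'
  have e₁ : (c - (a + c) / 2) / (c - a) = 1 / 2 := by field_simp; ring
  have hgB : ∫ x in a..(a + c) / 2, g x = (c - a) / 2 * (1 / (2 ^ α * (α + 1)) * B3) := by
    rw [hg, integral_affine_rpow hα0 hL, e₀, e₁, hhalf, Real.one_rpow, hB3, h2]
    field_simp
    ring
  have hgA : ∫ x in (a + c) / 2..c, g x = (c - a) / 2 * (1 / (2 ^ α * (α + 1)) * A3) := by
    rw [hg, integral_affine_rpow hα0 hL, e₁, hhalf, sub_self, zero_div, Real.zero_rpow hα1, hA3]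
    field_simp
    ring
  have hwB : ∫ x in a..(a + c) / 2, |x - a| ^ p = ((c - a) / 2) ^ (p + 1) / (p + 1) := by
    rw [intervalIntegral.integral_comp_sub_right (fun y => |y| ^ p) a, sub_self,
      show (a + c) / 2 - a = (c - a) / 2 by ring, ← integral_zero_rpow hp]
    refine intervalIntegral.integral_congr fun x hx => ?_
    rw [uIcc_of_le hh.le] at hx
    simp only [abs_of_nonneg hx.1]
  have hwA : ∫ x in (a + c) / 2..c, |x - c| ^ p = ((c - a) / 2) ^ (p + 1) / (p + 1) := by
    simp only [abs_sub_comm _ c]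
    rw [intervalIntegral.integral_comp_sub_left (fun y => |y| ^ p) c, sub_self,
      show c - (a + c) / 2 = (c - a) / 2 by ring, ← integral_zero_rpow hp]
    refine intervalIntegral.integral_congr fun x hx => ?_
    rw [uIcc_of_le hh.le] at hx
    simp only [abs_of_nonneg hx.1]
  obtain ⟨hB, hBle⟩ := abs_integral_mul_le_of_integral_eq hh (by ring) hHC (by fun_prop) hgc
    (fun x hx => hφ x ⟨hx.1, by linarith [hx.2]⟩) hwB hgB
  obtain ⟨hA, hAle⟩ := abs_integral_mul_le_of_integral_eq hh (by ring) hHC (by fun_prop) hgc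
    (fun x hx => hφ x ⟨by linarith [hx.1], hx.2⟩) hwA hgA
  have hk : 0 < 1 / (2 ^ α * (α + 1)) := by positivity
  rw [Real.mul_rpow hk.le (nonneg_of_mul_nonneg_right hB hk)] at hBle
  rw [Real.mul_rpow hk.le (nonneg_of_mul_nonneg_right hA hk)] at hAle
  rw [abs_mul, abs_of_pos (one_div_pos.2 hL)]
  refine (mul_le_mul_of_nonneg_left ((abs_add_le _ _).trans (add_le_add hBle hAle))
    (one_div_pos.2 hL).le).trans_eq ?_
  generalize (1 / (p + 1)) ^ (1 / p) = P
  generalize (1 / (2 ^ α * (α + 1))) ^ (1 / q) = Q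
  field_simp
  ring
end
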